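/- For every real r ≥ 0, the entire function E(z) := ∑_{n=0}^∞ zⁿ/η_n satisfies e^r ≤ E(r) ≤ 8 e^{2r}; in particular e^{|z|} ≤ E(|z|) ≤ 8 e^{2|z|} for every z ∈ ℂ. -/

import Mathlib

open MeasureTheory

/-- The moment sequence of the Hörmander-Fock space. -/
noncomputable def eta (n : ℕ) : ℝ :=
  ∫ t in Set.Ioi (0 : ℝ), t ^ n / (1 + t) ^ 2 * Real.exp (-t)

/-- The special entire function `E` restricted to real arguments. -/
noncomputable def Efun (r : ℝ) : ℝ := ∑' n : ℕ, r ^ n / eta n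

theorem integral_pow_mul_exp_neg_mul_Ioi (n : ℕ) {c : ℝ} (hc : 0 < c) :
    ∫ t in Set.Ioi (0 : ℝ), t ^ n * Real.exp (-(c * t)) = n.factorial / c ^ (n + 1) := by
  have h := Real.integral_rpow_mul_exp_neg_mul_Ioi (a := (n : ℝ) + 1) (by positivity) hc
  rw [Real.Gamma_nat_eq_factorial, add_sub_cancel_right] at h
  simp only [Real.rpow_natCast] at h
  rw [h, show (n : ℝ) + 1 = ((n + 1 : ℕ) : ℝ) by push_cast; ring, Real.rpow_natCast, one_div,
    inv_pow]
  field_simp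

theorem integrableOn_pow_mul_exp_neg_mul_Ioi (n : ℕ) {c : ℝ} (hc : 0 < c) :
    IntegrableOn (fun t : ℝ => t ^ n * Real.exp (-(c * t))) (Set.Ioi 0) := by
  apply Integrable.of_integral_ne_zero
  rw [integral_pow_mul_exp_neg_mul_Ioi n hc]
  positivity

theorem eta_integrand_le (n : ℕ) {t : ℝ} (ht : 0 < t) :
    t ^ n / (1 + t) ^ 2 * Real.exp (-t) ≤ t ^ n * Real.exp (-(1 * t)) := by
  rw [one_mul]
  gcongr
  exact div_le_self (by positivity) (by nlinarith)

theorem le_eta_integrand (n : ℕ) {t : ℝ} (ht : 0 < t) :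
    1 / 4 * (t ^ n * Real.exp (-(2 * t))) ≤ t ^ n / (1 + t) ^ 2 * Real.exp (-t) := by
  have h1 : 1 + t ≤ 2 * Real.exp (t / 2) := by
    linarith [Real.add_one_le_exp (t / 2)]
  have h2 : (1 + t) ^ 2 ≤ 4 * Real.exp t := by
    calc (1 + t) ^ 2 ≤ (2 * Real.exp (t / 2)) ^ 2 := by gcongr
      _ = 4 * Real.exp t := by
        rw [mul_pow, ← Real.exp_nat_mul]
        norm_num
        ring_nf
  have h3 : Real.exp (-(2 * t)) = Real.exp (-t) / Real.exp t := by
    rw [← Real.exp_sub]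
    ring_nf
  calc 1 / 4 * (t ^ n * Real.exp (-(2 * t)))
      = t ^ n / (4 * Real.exp t) * Real.exp (-t) := by rw [h3]; field_simp
    _ ≤ t ^ n / (1 + t) ^ 2 * Real.exp (-t) := by gcongr

theorem integrableOn_eta_integrand (n : ℕ) :
    IntegrableOn (fun t : ℝ => t ^ n / (1 + t) ^ 2 * Real.exp (-t)) (Set.Ioi 0) := by
  refine (integrableOn_pow_mul_exp_neg_mul_Ioi n one_pos).mono'
    (Measurable.aestronglyMeasurable (by fun_prop)) ?_
  filter_upwards [ae_restrict_mem measurableSet_Ioi] with t ht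
  have ht' : 0 < t := ht
  rw [Real.norm_of_nonneg (by positivity)]
  exact eta_integrand_le n ht'

theorem eta_le_factorial (n : ℕ) : eta n ≤ n.factorial := by
  calc eta n ≤ ∫ t in Set.Ioi (0 : ℝ), t ^ n * Real.exp (-(1 * t)) :=
        setIntegral_mono_on (integrableOn_eta_integrand n)
          (integrableOn_pow_mul_exp_neg_mul_Ioi n one_pos) measurableSet_Ioi
          fun _ ht => eta_integrand_le n ht
    _ = n.factorial := by rw [integral_pow_mul_exp_neg_mul_Ioi n one_pos]; simp

theorem factorial_div_le_eta (n : ℕ) : (n.factorial : ℝ) / (8 * 2 ^ n) ≤ eta n := by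
  calc (n.factorial : ℝ) / (8 * 2 ^ n)
      = ∫ t in Set.Ioi (0 : ℝ), 1 / 4 * (t ^ n * Real.exp (-(2 * t))) := by
        rw [integral_const_mul, integral_pow_mul_exp_neg_mul_Ioi n two_pos, pow_succ]
        field_simp
        norm_num
    _ ≤ eta n :=
        setIntegral_mono_on ((integrableOn_pow_mul_exp_neg_mul_Ioi n two_pos).const_mul _)
          (integrableOn_eta_integrand n) measurableSet_Ioi fun _ ht => le_eta_integrand n ht

theorem eta_pos (n : ℕ) : 0 < eta n :=
  lt_of_lt_of_le (by positivity) (factorial_div_le_eta n)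

theorem hasSum_pow_div_factorial (x : ℝ) :
    HasSum (fun n : ℕ => x ^ n / n.factorial) (Real.exp x) := by
  rw [Real.exp_eq_exp_ℝ]
  exact NormedSpace.expSeries_div_hasSum_exp x

theorem exp_le_Efun_le {r : ℝ} (hr : 0 ≤ r) :
    Real.exp r ≤ Efun r ∧ Efun r ≤ 8 * Real.exp (2 * r) := by
  have hlow (n : ℕ) : r ^ n / n.factorial ≤ r ^ n / eta n :=
    div_le_div_of_nonneg_left (by positivity) (eta_pos n) (eta_le_factorial n)
  have hup (n : ℕ) : r ^ n / eta n ≤ 8 * ((2 * r) ^ n / n.factorial) := by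
    calc r ^ n / eta n ≤ r ^ n / (n.factorial / (8 * 2 ^ n)) :=
          div_le_div_of_nonneg_left (by positivity) (by positivity) (factorial_div_le_eta n)
      _ = 8 * ((2 * r) ^ n / n.factorial) := by
          rw [mul_pow]
          field_simp
  have hmajorant := (hasSum_pow_div_factorial (2 * r)).mul_left 8
  have hE : HasSum (fun n : ℕ => r ^ n / eta n) (Efun r) :=
    (Summable.of_nonneg_of_le (fun n => div_nonneg (by positivity) (eta_pos n).le) hup
      hmajorant.summable).hasSum
  exact ⟨hasSum_le hlow (hasSum_pow_div_factorial r) hE, hasSum_le hup hE hmajorant⟩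

theorem stmt_4 :
    (∀ r : ℝ, 0 ≤ r → Real.exp r ≤ Efun r ∧ Efun r ≤ 8 * Real.exp (2 * r)) ∧
      ∀ z : ℂ, Real.exp ‖z‖ ≤ Efun ‖z‖ ∧ Efun ‖z‖ ≤ 8 * Real.exp (2 * ‖z‖) :=
  ⟨fun _ hr => exp_le_Efun_le hr, fun z => exp_le_Efun_le (norm_nonneg z)⟩
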